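/- Let G = (V₁,E₁) be a connected graph with |V₁| ≥ 2 and H = (V₂,E₂) an arbitrary graph with |V₂| ≥ 1, with adjacency matrix A_H. Assume −2 − ψ_{H*}⁻¹(QEC(G)) ∉ ev(A_H). Then the set Λ = λ(S_{G⊙H}) ∩ {λ ∈ ℝ : det(A_H + (2+λ)I) ≠ 0} is nonempty, max Λ = ψ_{H*}⁻¹(QEC(G)), and moreover λ* < ψ_{H*}⁻¹(−1) ≤ max Λ, where λ* is the largest zero of ω_H. -/

import Mathlib

open scoped BigOperators
open Filter Topology
open scoped Classical

namespace QECPaper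

/-- The cone (join) `K₁ + H` over a graph `H`: vertex `none` is the apex. -/
def cone {V₂ : Type*} (H : SimpleGraph V₂) : SimpleGraph (Option V₂) where
  Adj x y := (∃ a b, x = some a ∧ y = some b ∧ H.Adj a b) ∨
    (x = none ∧ y ≠ none) ∨ (x ≠ none ∧ y = none)
  symm := by
    refine ⟨?_⟩
    rintro x y (⟨a, b, rfl, rfl, h⟩ | ⟨rfl, hy⟩ | ⟨hx, rfl⟩)
    · exact Or.inl ⟨b, a, rfl, rfl, h.symm⟩
    · exact Or.inr (Or.inr ⟨hy, rfl⟩)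
    · exact Or.inr (Or.inl ⟨rfl, hx⟩)
  loopless := by
    refine ⟨?_⟩
    rintro x (⟨a, b, rfl, hb, h⟩ | ⟨rfl, hy⟩ | ⟨hx, rfl⟩)
    · exact H.loopless.irrefl a (by cases hb; exact h)
    · exact hy rfl
    · exact hx rfl

/-- The corona `G ⊙ H` of two graphs, realized on `V₁ × ({o} ∪ V₂)`
with `o = none`. -/
def corona {V₁ V₂ : Type*} (G : SimpleGraph V₁) (H : SimpleGraph V₂) :
    SimpleGraph (V₁ × Option V₂) where
  Adj p q := (p.1 = q.1 ∧ (cone H).Adj p.2 q.2) ∨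
    (G.Adj p.1 q.1 ∧ p.2 = none ∧ q.2 = none)
  symm := by
    refine ⟨?_⟩
    rintro ⟨i, x⟩ ⟨j, y⟩ (⟨h1, h2⟩ | ⟨h1, h2, h3⟩)
    · exact Or.inl ⟨h1.symm, (cone H).symm.symm _ _ h2⟩
    · exact Or.inr ⟨h1.symm, h3, h2⟩
  loopless := by
    refine ⟨?_⟩
    rintro ⟨i, x⟩ (⟨h1, h2⟩ | ⟨h1, h2, h3⟩)
    · exact (cone H).loopless.irrefl x h2
    · exact G.loopless.irrefl i h1

/-- The quadratic embedding constant of a (connected) graph on a finite vertex set. -/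
noncomputable def QEC {V : Type*} [Fintype V] (G : SimpleGraph V) : ℝ :=
  sSup {r : ℝ | ∃ f : V → ℝ, (∑ x, f x ^ 2) = 1 ∧ (∑ x, f x) = 0 ∧
    r = ∑ x, ∑ y, f x * (G.dist x y : ℝ) * f y}

/-- The set `λ(S)` of `λ` appearing in a solution of the basic equations. -/
def lambdaS {V : Type*} [Fintype V] (G : SimpleGraph V) : Set ℝ :=
  {lam : ℝ | ∃ (f : V → ℝ) (μ : ℝ),
    (∀ x, (∑ y, (G.dist x y : ℝ) * f y) - lam * f x = μ / 2) ∧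
    (∑ x, f x) = 0 ∧ (∑ x, f x ^ 2) = 1}

/-- The distance matrix of a graph, with real entries. -/
noncomputable def distMatrix {V : Type*} (G : SimpleGraph V) : Matrix V V ℝ :=
  Matrix.of fun x y => (G.dist x y : ℝ)

section MatrixFunctions

variable {ι : Type*} [Fintype ι] [DecidableEq ι]

/-- The eigenspace `ker (A - α)` inside `EuclideanSpace ℝ ι`. -/
noncomputable def eigSpace (A : Matrix ι ι ℝ) (α : ℝ) :
    Submodule ℝ (EuclideanSpace ℝ ι) :=
  LinearMap.ker (Matrix.toEuclideanLin A - α • LinearMap.id)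

/-- The all-ones vector of `EuclideanSpace ℝ ι`. -/
noncomputable def onesE (ι : Type*) [Fintype ι] : EuclideanSpace ℝ ι :=
  (WithLp.equiv 2 (ι → ℝ)).symm (fun _ => 1)

/-- `‖E_α 𝟏‖²`, where `E_α` is the orthogonal projection of `EuclideanSpace ℝ ι`
onto the eigenspace `ker (A - α)`. -/
noncomputable def projNormSq (A : Matrix ι ι ℝ) (α : ℝ) : ℝ :=
  ‖(Submodule.orthogonalProjectionOnto (eigSpace A α) (onesE ι) : EuclideanSpace ℝ ι)‖ ^ 2

/-- The set of (real) eigenvalues of a matrix. -/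
def evSet (A : Matrix ι ι ℝ) : Set ℝ :=
  {α : ℝ | ∃ v : ι → ℝ, v ≠ 0 ∧ A.mulVec v = α • v}

/-- The set of main eigenvalues: those `α` with `E_α 𝟏 ≠ 0`. -/
def mainEv (A : Matrix ι ι ℝ) : Set ℝ := {α : ℝ | projNormSq A α ≠ 0}

/-- `k_A = |ev_M(A) \ {-2}|`. -/
noncomputable def kA (A : Matrix ι ι ℝ) : ℕ := (mainEv A \ {(-2 : ℝ)}).ncard

/-- The ω-function associated with the symmetric matrix `A`. -/
noncomputable def omegaFun (A : Matrix ι ι ℝ) (lam : ℝ) : ℝ :=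
  1 + projNormSq A (-2) +
    ∑ᶠ α ∈ mainEv A \ {(-2 : ℝ)}, lam / (α + 2 + lam) * projNormSq A α

/-- The (maximal) domain of the ω-function: the complement of its poles. -/
def omegaDomain (A : Matrix ι ι ℝ) : Set ℝ :=
  {lam : ℝ | ∀ α ∈ mainEv A \ {(-2 : ℝ)}, lam ≠ -α - 2}

/-- The set of zeroes of the ω-function (on its domain). -/
def omegaZeros (A : Matrix ι ι ℝ) : Set ℝ :=
  {lam : ℝ | lam ∈ omegaDomain A ∧ omegaFun A lam = 0}

/-- `λ*`, the largest zero of the ω-function. -/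
noncomputable def lamStar (A : Matrix ι ι ℝ) : ℝ := sSup (omegaZeros A)

/-- The ψ-function associated with `A`: `ψ_A(λ) = λ/ω_A(λ)` extended
analytically across the poles of `ω_A` by the value `0`. -/
noncomputable def psiFun (A : Matrix ι ι ℝ) (lam : ℝ) : ℝ :=
  if -lam - 2 ∈ mainEv A \ {(-2 : ℝ)} then 0 else lam / omegaFun A lam

/-- The inverse of the rightmost branch `ψ_{A*} = ψ_A ↾ (λ*, +∞)`:
`ψ_{A*}⁻¹(y)` is the unique `λ > λ*` with `ψ_A(λ) = y`. -/
noncomputable def psiStarInv (A : Matrix ι ι ℝ) (y : ℝ) : ℝ :=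
  sSup {lam : ℝ | lamStar A < lam ∧ psiFun A lam = y}

end MatrixFunctions

section PoleAnalysis

variable {t₁ t₂ c₁ C z : ℝ} {R : ℝ → ℝ}

theorem poleDenominator_pos (hc : 0 < c₁) (hanti : AntitoneOn R (Set.Ioi t₂))
    (hpos : ∀ x ∈ Set.Ioi t₂, 0 < R x) (hz₂ : t₂ < z) (hz : c₁ + (z - t₁) * R z = 0)
    {x : ℝ} (hx : z < x) : 0 < c₁ + (x - t₁) * R x := by
  have hRx := hpos x (hz₂.trans hx)
  rcases le_or_gt t₁ x with h | h
  · have := mul_nonneg (sub_nonneg.2 h) hRx.le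
    linarith
  · have hR := hanti (Set.mem_Ioi.2 hz₂) (Set.mem_Ioi.2 (hz₂.trans hx)) hx.le
    have hRz := hpos z hz₂
    nlinarith

theorem strictMonoOn_poleQuotient (hc : 0 < c₁) (hanti : AntitoneOn R (Set.Ioi t₂))
    (hpos : ∀ x ∈ Set.Ioi t₂, 0 < R x) (hz₂ : t₂ < z) (hz : c₁ + (z - t₁) * R z = 0) :
    StrictMonoOn (fun x => (x - t₁) / (c₁ + (x - t₁) * R x)) (Set.Ioi z) := by
  intro x hx y hy hxy
  have hux := poleDenominator_pos hc hanti hpos hz₂ hz hx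
  have huy := poleDenominator_pos hc hanti hpos hz₂ hz hy
  have hR := hanti (Set.mem_Ioi.2 (hz₂.trans hx)) (Set.mem_Ioi.2 (hz₂.trans hy)) hxy.le
  simp only
  rw [div_lt_div_iff₀ hux huy]
  by_cases hs : 0 ≤ (x - t₁) * (y - t₁)
  · nlinarith [mul_nonneg hs (sub_nonneg.2 hR)]
  · have h₁ : x - t₁ < 0 := by
      by_contra h
      exact hs (mul_nonneg (not_lt.1 h) (by linarith [not_lt.1 h]))
    have h₂ : 0 < y - t₁ := by
      by_contra h
      exact hs (mul_nonneg_of_nonpos_of_nonpos h₁.le (not_lt.1 h))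
    nlinarith [mul_pos h₂ hux, mul_neg_of_neg_of_pos h₁ huy]

theorem exists_poleQuotient_eq (hc : 0 < c₁) (hanti : AntitoneOn R (Set.Ioi t₂))
    (hpos : ∀ x ∈ Set.Ioi t₂, 0 < R x) (hcont : ContinuousOn R (Set.Ioi t₂))
    (hbound : ∀ x, t₁ ≤ x → c₁ + (x - t₁) * R x ≤ C)
    (hz₂ : t₂ < z) (hz₁ : z < t₁) (hz : c₁ + (z - t₁) * R z = 0) (y : ℝ) :
    ∃ x, z < x ∧ (x - t₁) / (c₁ + (x - t₁) * R x) = y := by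
  have hC : 0 ≤ C := by
    have := hbound t₁ le_rfl
    simp at this
    linarith
  set b := t₁ + (|y| * C + 1) with hb
  have hM : 0 ≤ |y| * C := mul_nonneg (abs_nonneg y) hC
  have hzb : z ≤ b := by linarith
  let F : ℝ → ℝ := fun x => (x - t₁) - y * (c₁ + (x - t₁) * R x)
  have hF : ContinuousOn F (Set.Icc z b) := by
    have : ContinuousOn R (Set.Icc z b) := hcont.mono fun x hx => hz₂.trans_le hx.1
    fun_prop
  have hFz : F z < 0 := by
    simp only [F, hz]
    linarith
  have hFb : 0 ≤ F b := by
    have h₁ := hbound b (by linarith)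
    have h₀ := poleDenominator_pos hc hanti hpos hz₂ hz (x := b) (by linarith)
    have h₂ : y * (c₁ + (b - t₁) * R b) ≤ |y| * C :=
      (mul_le_mul_of_nonneg_right (le_abs_self y) h₀.le).trans
        (mul_le_mul_of_nonneg_left h₁ (abs_nonneg y))
    simp only [F]
    linarith
  obtain ⟨x, hx, hFx⟩ := intermediate_value_Icc hzb hF ⟨hFz.le, hFb⟩
  have hzx : z < x := by
    refine lt_of_le_of_ne hx.1 ?_
    rintro rfl
    exact hFz.ne hFx
  refine ⟨x, hzx, ?_⟩
  rw [div_eq_iff (poleDenominator_pos hc hanti hpos hz₂ hz hzx).ne']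
  simp only [F] at hFx
  linarith

theorem exists_poleDenominator_eq_zero {c₂ : ℝ} (hc : 0 < c₁) (hc₂ : 0 < c₂) (ht : t₂ < t₁)
    (hcont : ContinuousOn R (Set.Ioi t₂)) (hR : ∀ x ∈ Set.Ioi t₂, c₂ / (x - t₂) ≤ R x) :
    ∃ z, t₂ < z ∧ z < t₁ ∧ c₁ + (z - t₁) * R z = 0 := by
  set a := t₂ + (t₁ - t₂) * c₂ / (c₁ + c₂) with ha
  have hd : 0 < t₁ - t₂ := sub_pos.2 ht
  have ha₂ : t₂ < a := by
    rw [ha]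
    have : 0 < (t₁ - t₂) * c₂ / (c₁ + c₂) := by positivity
    linarith
  have hkey : (t₁ - a) * (c₂ / (a - t₂)) = c₁ := by
    have : a - t₂ = (t₁ - t₂) * c₂ / (c₁ + c₂) := by rw [ha]; ring
    have h' : t₁ - a = (t₁ - t₂) * c₁ / (c₁ + c₂) := by
      rw [ha]
      field_simp
      ring
    rw [this, h']
    field_simp
  have ha₁ : a < t₁ := by
    by_contra h
    have : 0 < c₂ / (a - t₂) := div_pos hc₂ (sub_pos.2 ha₂)
    nlinarith [not_lt.1 h]
  let u : ℝ → ℝ := fun x => c₁ + (x - t₁) * R x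
  have hu : ContinuousOn u (Set.Icc a t₁) := by
    have : ContinuousOn R (Set.Icc a t₁) := hcont.mono fun x hx => ha₂.trans_le hx.1
    fun_prop
  have hua : u a ≤ 0 := by
    have := mul_le_mul_of_nonneg_left (hR a ha₂) (sub_pos.2 ha₁).le
    simp only [u]
    linarith
  have hut : 0 < u t₁ := by simpa [u] using hc
  obtain ⟨z, hz, huz⟩ := intermediate_value_Icc ha₁.le hu ⟨hua, hut.le⟩
  refine ⟨z, ha₂.trans_le hz.1, lt_of_le_of_ne hz.2 ?_, huz⟩
  rintro rfl
  exact hut.ne' huz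

end PoleAnalysis

/-- The largest pole of a finite sum of simple poles with positive residues, split off from
the remaining ones. -/
theorem exists_rightmost_branch (S : Finset ℝ) (c : ℝ → ℝ) (hS : S.Nontrivial)
    (hc : ∀ t ∈ S, 0 < c t) :
    ∃ (t₁ z : ℝ) (u : ℝ → ℝ), t₁ ∈ S ∧ z < t₁ ∧ u z = 0 ∧ (∀ x, z < x → 0 < u x) ∧
      (∀ x ∈ S, z ≤ x → x = t₁) ∧
      (∀ x, x ≠ t₁ → u x = (x - t₁) * ∑ t ∈ S, c t / (x - t)) ∧
      StrictMonoOn (fun x => (x - t₁) / u x) (Set.Ioi z) ∧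
      ∀ y, ∃ x, z < x ∧ (x - t₁) / u x = y := by
  obtain ⟨t₁, ht₁, hmax₁⟩ := S.exists_max_image id hS.nonempty
  have hne : (S.erase t₁).Nonempty := by
    obtain ⟨b, hb, hbne⟩ := hS.exists_ne t₁
    exact ⟨b, Finset.mem_erase.2 ⟨hbne, hb⟩⟩
  obtain ⟨t₂, ht₂, hmax₂⟩ := (S.erase t₁).exists_max_image id hne
  simp only [id] at hmax₁ hmax₂
  have ht₂S := Finset.mem_of_mem_erase ht₂
  have hlt : t₂ < t₁ := lt_of_le_of_ne (hmax₁ _ ht₂S) (Finset.ne_of_mem_erase ht₂)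
  let R : ℝ → ℝ := fun x => ∑ t ∈ S.erase t₁, c t / (x - t)
  have hsub : ∀ x ∈ Set.Ioi t₂, ∀ t ∈ S.erase t₁, 0 < x - t := fun x hx t ht => by
    have := hmax₂ t ht
    have : t₂ < x := hx
    linarith
  have hct : ∀ t ∈ S.erase t₁, 0 < c t := fun t ht => hc t (Finset.mem_of_mem_erase ht)
  have hpos : ∀ x ∈ Set.Ioi t₂, 0 < R x := fun x hx =>
    Finset.sum_pos (fun t ht => div_pos (hct t ht) (hsub x hx t ht)) hne
  have hanti : AntitoneOn R (Set.Ioi t₂) := fun x hx y hy hxy =>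
    Finset.sum_le_sum fun t ht =>
      div_le_div_of_nonneg_left (hct t ht).le (hsub x hx t ht) (by linarith)
  have hcont : ContinuousOn R (Set.Ioi t₂) :=
    continuousOn_finsetSum _ fun t ht =>
      continuousOn_const.div (by fun_prop) fun x hx => (hsub x hx t ht).ne'
  have hbound : ∀ x, t₁ ≤ x → c t₁ + (x - t₁) * R x ≤ c t₁ + ∑ t ∈ S.erase t₁, c t := by
    intro x hx
    simp only [R, Finset.mul_sum]
    gcongr with t ht
    have h₁ := hsub x (hlt.trans_le hx) t ht
    have h₂ := hmax₁ t (Finset.mem_of_mem_erase ht)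
    have h₃ := hct t ht
    rw [mul_div_assoc', div_le_iff₀ h₁, mul_comm]
    gcongr
  have hlow : ∀ x ∈ Set.Ioi t₂, c t₂ / (x - t₂) ≤ R x := fun x hx =>
    Finset.single_le_sum (f := fun t => c t / (x - t))
      (fun t ht => (div_pos (hct t ht) (hsub x hx t ht)).le) ht₂
  obtain ⟨z, hz₂, hz₁, hz⟩ :=
    exists_poleDenominator_eq_zero (hc t₁ ht₁) (hct t₂ ht₂) hlt hcont hlow
  refine ⟨t₁, z, fun x => c t₁ + (x - t₁) * R x, ht₁, hz₁, hz,
    fun x hx => poleDenominator_pos (hc t₁ ht₁) hanti hpos hz₂ hz hx, ?_, ?_,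
    strictMonoOn_poleQuotient (hc t₁ ht₁) hanti hpos hz₂ hz,
    exists_poleQuotient_eq (hc t₁ ht₁) hanti hpos hcont hbound hz₂ hz₁ hz⟩
  · intro x hx hzx
    by_contra h
    have := hmax₂ x (Finset.mem_erase.2 ⟨h, hx⟩)
    linarith
  · intro x hx
    have : x - t₁ ≠ 0 := sub_ne_zero.2 hx
    simp only [R]
    rw [← Finset.add_sum_erase S _ ht₁]
    field_simp

theorem dist_eq_of_potential {V : Type*} (Γ : SimpleGraph V) (q : V) (d : V → ℕ) (hq : d q = 0)
    (hzero : ∀ p, d p = 0 → p = q) (hlip : ∀ p p', Γ.Adj p p' → d p ≤ d p' + 1)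
    (hdesc : ∀ p k, d p = k + 1 → ∃ p', Γ.Adj p p' ∧ d p' = k) (p : V) : Γ.dist p q = d p := by
  have hwalk : ∀ k p, d p = k → ∃ w : Γ.Walk p q, w.length = k := by
    intro k
    induction k with
    | zero =>
      intro p hp
      obtain rfl := hzero p hp
      exact ⟨SimpleGraph.Walk.nil, rfl⟩
    | succ k ih =>
      intro p hp
      obtain ⟨p', hadj, hp'⟩ := hdesc p k hp
      obtain ⟨w, hw⟩ := ih p' hp'
      exact ⟨SimpleGraph.Walk.cons hadj w, by simp [hw]⟩
  have hlow : ∀ {a b : V} (w : Γ.Walk a b), d a ≤ d b + w.length := by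
    intro a b w
    induction w with
    | nil => simp
    | cons h w ih =>
      have := hlip _ _ h
      simp only [SimpleGraph.Walk.length_cons]
      omega
  obtain ⟨w, hw⟩ := hwalk _ p rfl
  refine le_antisymm ((SimpleGraph.dist_le w).trans hw.le) ?_
  obtain ⟨w', hw'⟩ := w.reachable.exists_walk_length_eq_dist
  have := hlow w'
  omega

/-- The graph distance of `G ⊙ H`, computed from that of `G` and adjacency in `H`. -/
noncomputable def coronaDist {V₁ V₂ : Type*} (G : SimpleGraph V₁) (H : SimpleGraph V₂)
    (q p : V₁ × Option V₂) : ℕ :=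
  match p, q with
  | (i, none), (j, none) => G.dist i j
  | (i, none), (j, some _) => G.dist i j + 1
  | (i, some _), (j, none) => G.dist i j + 1
  | (i, some a), (j, some b) =>
    if i = j then (if a = b then 0 else if H.Adj a b then 1 else 2) else G.dist i j + 2

theorem corona_dist {V₁ V₂ : Type*} {G : SimpleGraph V₁} (H : SimpleGraph V₂)
    (hG : G.Connected) (p q : V₁ × Option V₂) : (corona G H).dist p q = coronaDist G H q p := by
  have hlipG : ∀ {i i' : V₁} (j : V₁), G.Adj i i' → G.dist i j ≤ G.dist i' j + 1 := by
    intro i i' j h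
    have h₁ := hG.dist_triangle (u := i) (v := i') (w := j)
    rw [SimpleGraph.dist_eq_one_iff_adj.2 h] at h₁
    omega
  have hdescG : ∀ {i j : V₁} {k : ℕ}, G.dist i j = k + 1 → ∃ i', G.Adj i i' ∧ G.dist i' j = k := by
    intro i j k h
    obtain ⟨w, hw⟩ := hG.exists_walk_length_eq_dist i j
    cases w with
    | nil => simp at h
    | cons hadj w =>
      refine ⟨_, hadj, ?_⟩
      have h₁ := SimpleGraph.dist_le w
      have h₂ := hlipG j hadj
      simp only [SimpleGraph.Walk.length_cons] at hw
      omega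
  obtain ⟨j, y⟩ := q
  refine dist_eq_of_potential _ (j, y) _ ?_ ?_ ?_ ?_ p
  · cases y <;> simp [coronaDist]
  · rintro ⟨i, _ | a⟩ h
    · cases y <;> simp_all [coronaDist, hG.dist_eq_zero_iff]
    · cases y with
      | none => simp [coronaDist] at h
      | some b =>
        simp only [coronaDist] at h
        split_ifs at h
        simp_all
  · rintro ⟨i, x⟩ ⟨i', x'⟩ (⟨h₁, h₂⟩ | ⟨h₁, h₂, h₃⟩)
    · simp only at h₁ h₂
      subst h₁
      rcases h₂ with ⟨a, b, rfl, rfl, hab⟩ | ⟨rfl, hx⟩ | ⟨hx, rfl⟩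
      · cases y with
        | none => simp [coronaDist]
        | some b' =>
          simp only [coronaDist]
          split_ifs <;> simp_all
      · obtain ⟨a, rfl⟩ := Option.ne_none_iff_exists'.1 hx
        cases y with
        | none => simp only [coronaDist]; omega
        | some b =>
          by_cases hij : i = j
          · simp [coronaDist, hij]
          · simp only [coronaDist, hij, if_false]
            omega
      · obtain ⟨a, rfl⟩ := Option.ne_none_iff_exists'.1 hx
        cases y with
        | none => simp [coronaDist]
        | some b =>
          simp only [coronaDist]
          split_ifs <;> omega
    · simp only at h₁ h₂ h₃
      subst h₂ h₃
      have := hlipG j h₁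
      cases y <;> simp only [coronaDist] <;> omega
  · have hup : ∀ (i : V₁) (a : V₂), (corona G H).Adj (i, some a) (i, none) := fun i a =>
      Or.inl ⟨rfl, Or.inr (Or.inr ⟨by simp, rfl⟩)⟩
    have hacross : ∀ {i i' : V₁}, G.Adj i i' → (corona G H).Adj (i, none) (i', none) := fun h =>
      Or.inr ⟨h, rfl, rfl⟩
    rintro ⟨i, _ | a⟩ k h
    · cases y with
      | none =>
        obtain ⟨i', hadj, hi'⟩ := hdescG (show G.dist i j = k + 1 from h)
        exact ⟨_, hacross hadj, hi'⟩
      | some b =>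
        have h' : G.dist i j = k := by simpa [coronaDist] using h
        cases k with
        | zero =>
          obtain rfl := hG.dist_eq_zero_iff.1 h'
          exact ⟨_, (hup i b).symm, by simp [coronaDist]⟩
        | succ k =>
          obtain ⟨i', hadj, hi'⟩ := hdescG h'
          exact ⟨_, hacross hadj, by simp [coronaDist, hi']⟩
    · cases y with
      | none => exact ⟨_, hup i a, by simpa [coronaDist] using h⟩
      | some b =>
        simp only [coronaDist] at h
        split_ifs at h with hij hab hadj
        · obtain rfl : k = 0 := by omega
          subst hij
          exact ⟨(i, some b), Or.inl ⟨rfl, Or.inl ⟨a, b, rfl, rfl, hadj⟩⟩, by simp [coronaDist]⟩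
        · obtain rfl : k = 1 := by omega
          subst hij
          exact ⟨_, hup i a, by simp [coronaDist]⟩
        · exact ⟨_, hup i a, by simp only [coronaDist]; omega⟩

section QECLagrange

variable {V : Type*} [Fintype V]

/-- The quadratic form of the distance matrix. -/
noncomputable def distForm (G : SimpleGraph V) (f : V → ℝ) : ℝ :=
  ∑ x, ∑ y, f x * (G.dist x y : ℝ) * f y

theorem exists_isMaxOn_distForm (G : SimpleGraph V) (hV : 2 ≤ Fintype.card V) :
    ∃ f : V → ℝ, (∑ x, f x ^ 2) = 1 ∧ (∑ x, f x) = 0 ∧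
      ∀ g : V → ℝ, (∑ x, g x ^ 2) = 1 → (∑ x, g x) = 0 → distForm G g ≤ distForm G f := by
  let K : Set (V → ℝ) := {f | (∑ x, f x ^ 2) = 1 ∧ (∑ x, f x) = 0}
  have hclosed : IsClosed K :=
    (isClosed_eq (by fun_prop) continuous_const).inter (isClosed_eq (by fun_prop) continuous_const)
  have hK : IsCompact K := by
    refine (isCompact_univ_pi fun _ : V => isCompact_Icc (a := (-1 : ℝ)) (b := 1)).of_isClosed_subset
      hclosed fun f hf x _ => ?_
    have : f x ^ 2 ≤ 1 := hf.1 ▸ Finset.single_le_sum (f := fun x => f x ^ 2)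
      (fun _ _ => sq_nonneg _) (Finset.mem_univ x)
    exact abs_le.1 ((sq_le_one_iff_abs_le_one _).1 this)
  have hne : K.Nonempty := by
    obtain ⟨a, b, hab⟩ := Fintype.exists_pair_of_one_lt_card hV
    refine ⟨fun x => (Real.sqrt 2)⁻¹ * ((if x = a then 1 else 0) - if x = b then 1 else 0), ?_, ?_⟩
    · have : ∀ x : V, ((if x = a then (1 : ℝ) else 0) - if x = b then 1 else 0) ^ 2 =
          (if x = a then 1 else 0) + if x = b then 1 else 0 := by
        intro x
        split_ifs <;> simp_all
      simp only [mul_pow, this, ← Finset.mul_sum, Finset.sum_add_distrib]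
      simp
      norm_num
    · simp [← Finset.mul_sum]
  obtain ⟨f, hf, hmax⟩ := hK.exists_isMaxOn hne (f := distForm G)
    (by unfold distForm; fun_prop)
  exact ⟨f, hf.1, hf.2, fun g h₁ h₂ => hmax ⟨h₁, h₂⟩⟩

theorem distForm_le_QEC (G : SimpleGraph V) (hV : 2 ≤ Fintype.card V) {f : V → ℝ}
    (h₁ : (∑ x, f x ^ 2) = 1) (h₀ : (∑ x, f x) = 0) : distForm G f ≤ QEC G := by
  obtain ⟨g, -, -, hg⟩ := exists_isMaxOn_distForm G hV
  refine le_csSup ⟨distForm G g, ?_⟩ ⟨f, h₁, h₀, rfl⟩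
  rintro _ ⟨k, hk₁, hk₀, rfl⟩
  exact hg k hk₁ hk₀

theorem exists_distForm_eq_QEC (G : SimpleGraph V) (hV : 2 ≤ Fintype.card V) :
    ∃ f : V → ℝ, (∑ x, f x ^ 2) = 1 ∧ (∑ x, f x) = 0 ∧ distForm G f = QEC G := by
  obtain ⟨f, hf₁, hf₀, hf⟩ := exists_isMaxOn_distForm G hV
  refine ⟨f, hf₁, hf₀, le_antisymm (distForm_le_QEC G hV hf₁ hf₀)
    (csSup_le ⟨_, f, hf₁, hf₀, rfl⟩ ?_)⟩
  rintro _ ⟨k, hk₁, hk₀, rfl⟩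
  exact hf k hk₁ hk₀

theorem distForm_le_QEC_mul (G : SimpleGraph V) (hV : 2 ≤ Fintype.card V) {f : V → ℝ}
    (h₀ : (∑ x, f x) = 0) : distForm G f ≤ QEC G * ∑ x, f x ^ 2 := by
  rcases (Finset.sum_nonneg fun x (_ : x ∈ Finset.univ) => sq_nonneg (f x)).eq_or_lt with h | h
  · have hf : f = 0 := by
      ext x
      have := (Finset.sum_eq_zero_iff_of_nonneg fun x _ => sq_nonneg (f x)).1 h.symm x
        (Finset.mem_univ x)
      simpa using this
    simp [hf, distForm]
  · set N := ∑ x, f x ^ 2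
    set s := (Real.sqrt N)⁻¹
    have hs : s ^ 2 = N⁻¹ := by simp [s, inv_pow, Real.sq_sqrt h.le]
    have hsc : distForm G (fun x => s * f x) = s ^ 2 * distForm G f := by
      simp only [distForm, Finset.mul_sum]
      exact Finset.sum_congr rfl fun x _ => Finset.sum_congr rfl fun y _ => by ring
    have := distForm_le_QEC G hV (f := fun x => s * f x)
      (by simp only [mul_pow, ← Finset.mul_sum, hs]; exact inv_mul_cancel₀ h.ne')
      (by rw [← Finset.mul_sum, h₀, mul_zero])
    rwa [hsc, hs, inv_mul_le_iff₀ h, mul_comm] at this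

/-- A quadratic form nonnegative on `ℝ` along a line and vanishing at its origin has vanishing
linear coefficient. -/
theorem linear_coeff_eq_zero {a b : ℝ} (h : ∀ t : ℝ, 0 ≤ a * t + b * t ^ 2) : a = 0 := by
  have hb : 0 < |b| + 1 := by positivity
  have h₁ := h (-a / (|b| + 1))
  have h₂ : a * (-a / (|b| + 1)) + b * (-a / (|b| + 1)) ^ 2 =
      a ^ 2 * (b - (|b| + 1)) / (|b| + 1) ^ 2 := by
    field_simp
    ring
  rw [h₂, le_div_iff₀ (by positivity), zero_mul] at h₁
  have := le_abs_self b
  nlinarith [sq_nonneg a]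

theorem QEC_mem_lambdaS (G : SimpleGraph V) (hV : 2 ≤ Fintype.card V) : QEC G ∈ lambdaS G := by
  obtain ⟨f, hf₁, hf₀, hf⟩ := exists_distForm_eq_QEC G hV
  let L : V → ℝ := fun x => QEC G * f x - ∑ y, (G.dist x y : ℝ) * f y
  have hgrad : ∀ g : V → ℝ, (∑ x, g x) = 0 → ∑ x, g x * L x = 0 := by
    intro g hg
    have hcross : ∑ x, ∑ y, f x * (G.dist x y : ℝ) * g y =
        ∑ x, ∑ y, g x * (G.dist x y : ℝ) * f y := by
      rw [Finset.sum_comm]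
      refine Finset.sum_congr rfl fun x _ => Finset.sum_congr rfl fun y _ => ?_
      rw [SimpleGraph.dist_comm]
      ring
    have hL : ∑ x, g x * L x =
        QEC G * ∑ x, f x * g x - ∑ x, ∑ y, g x * (G.dist x y : ℝ) * f y := by
      simp only [L, mul_sub, Finset.sum_sub_distrib, Finset.mul_sum]
      congr 1
      · exact Finset.sum_congr rfl fun x _ => by ring
      · exact Finset.sum_congr rfl fun x _ => Finset.sum_congr rfl fun y _ => by ring
    have key := linear_coeff_eq_zero (a := 2 * ∑ x, g x * L x)
      (b := QEC G * ∑ x, g x ^ 2 - distForm G g) fun t => by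
        have h := distForm_le_QEC_mul G hV (f := fun x => f x + t * g x)
          (by rw [Finset.sum_add_distrib, ← Finset.mul_sum, hf₀, hg]; simp)
        have e₁ : distForm G (fun x => f x + t * g x) = distForm G f +
            t * (∑ x, ∑ y, f x * (G.dist x y : ℝ) * g y) +
            t * (∑ x, ∑ y, g x * (G.dist x y : ℝ) * f y) + t ^ 2 * distForm G g := by
          simp only [distForm, Finset.mul_sum, ← Finset.sum_add_distrib]
          exact Finset.sum_congr rfl fun x _ => Finset.sum_congr rfl fun y _ => by ring
        have e₂ : ∑ x, (f x + t * g x) ^ 2 = ∑ x, f x ^ 2 + 2 * t * (∑ x, f x * g x) +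
            t ^ 2 * ∑ x, g x ^ 2 := by
          simp only [Finset.mul_sum, ← Finset.sum_add_distrib]
          exact Finset.sum_congr rfl fun x _ => by ring
        rw [e₁, e₂, hcross, hf, hf₁] at h
        rw [hL]
        linarith
    linarith
  have hconst : ∀ x y, L x = L y := by
    intro x y
    have := hgrad (fun v => (if v = x then 1 else 0) - if v = y then 1 else 0) (by simp)
    simp [sub_mul, Finset.sum_sub_distrib] at this
    linarith
  obtain ⟨o⟩ : Nonempty V := Fintype.card_pos_iff.1 (by omega)
  refine ⟨f, -2 * L o, fun x => ?_, hf₀, hf₁⟩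
  have := hconst x o
  simp only [L] at this ⊢
  linarith

theorem sum_sq_pos {f : V → ℝ} (hf : f ≠ 0) : 0 < ∑ x, f x ^ 2 := by
  obtain ⟨x, hx⟩ := Function.ne_iff.1 hf
  have hx' : f x ≠ 0 := hx
  exact Finset.sum_pos' (fun _ _ => sq_nonneg _) ⟨x, Finset.mem_univ x, by positivity⟩

theorem le_QEC_of_solution (G : SimpleGraph V) (hV : 2 ≤ Fintype.card V) {lam κ : ℝ} {f : V → ℝ}
    (hf : f ≠ 0) (h₀ : (∑ x, f x) = 0)
    (h : ∀ x, (∑ y, (G.dist x y : ℝ) * f y) - lam * f x = κ) : lam ≤ QEC G := by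
  have hN : 0 < ∑ x, f x ^ 2 := sum_sq_pos hf
  have hform : distForm G f = lam * ∑ x, f x ^ 2 := by
    have : ∀ x, ∑ y, f x * (G.dist x y : ℝ) * f y = lam * f x ^ 2 + κ * f x := by
      intro x
      rw [← h x]
      simp only [mul_assoc, ← Finset.mul_sum]
      ring
    simp only [distForm, this, Finset.sum_add_distrib, ← Finset.mul_sum, h₀]
    ring
  have := distForm_le_QEC_mul G hV h₀
  rw [hform] at this
  exact le_of_mul_le_mul_right this hN

theorem neg_one_le_QEC (G : SimpleGraph V) (hG : G.Connected) (hV : 2 ≤ Fintype.card V) :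
    -1 ≤ QEC G := by
  obtain ⟨a, c, hac⟩ := Fintype.exists_pair_of_one_lt_card hV
  have : Nontrivial V := ⟨a, c, hac⟩
  obtain ⟨b, hab⟩ := hG.preconnected.exists_adj_of_nontrivial a
  set f : V → ℝ := fun x => (if x = a then 1 else 0) - if x = b then 1 else 0 with hfdef
  have hsq : ∑ x, f x ^ 2 = 2 := by
    have : ∀ x : V, f x ^ 2 = (if x = a then 1 else 0) + if x = b then 1 else 0 := by
      intro x
      have := hab.ne
      simp only [hfdef]
      split_ifs <;> simp_all
    simp only [this, Finset.sum_add_distrib]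
    simp
    norm_num
  have hform : distForm G f = -2 := by
    have h₁ : G.dist a b = 1 := SimpleGraph.dist_eq_one_iff_adj.2 hab
    have h₂ : G.dist b a = 1 := SimpleGraph.dist_eq_one_iff_adj.2 hab.symm
    simp [distForm, hfdef, sub_mul, mul_sub, Finset.sum_sub_distrib, h₁, h₂]
    norm_num
  have := distForm_le_QEC_mul G hV (f := f) (by simp [hfdef])
  rw [hsq, hform] at this
  linarith

end QECLagrange

section Spectral

variable {ι : Type*} [Fintype ι] [DecidableEq ι] {A : Matrix ι ι ℝ}

/-- The component `E_α 𝟏` of the all-ones vector in the eigenspace `ker (A - α)`. -/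
noncomputable def onesComponent (A : Matrix ι ι ℝ) (α : ℝ) : EuclideanSpace ℝ ι :=
  (eigSpace A α).starProjection (onesE ι)

theorem projNormSq_eq_inner (A : Matrix ι ι ℝ) (α : ℝ) :
    projNormSq A α = inner ℝ (onesComponent A α) (onesE ι) := by
  have := Submodule.re_inner_starProjection_eq_normSq (𝕜 := ℝ) (eigSpace A α) (onesE ι)
  rw [RCLike.re_to_real] at this
  rw [onesComponent, this]
  rfl

theorem projNormSq_nonneg (A : Matrix ι ι ℝ) (α : ℝ) : 0 ≤ projNormSq A α := sq_nonneg _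

theorem onesComponent_eq_zero_iff {α : ℝ} : onesComponent A α = 0 ↔ α ∉ mainEv A := by
  have : projNormSq A α = ‖onesComponent A α‖ ^ 2 := rfl
  simp [mainEv, this]

theorem toEuclideanLin_onesComponent (A : Matrix ι ι ℝ) (α : ℝ) :
    Matrix.toEuclideanLin A (onesComponent A α) = α • onesComponent A α := by
  have : onesComponent A α ∈ eigSpace A α := Submodule.starProjection_apply_mem _ _
  simpa [eigSpace, sub_eq_zero] using this

theorem eigSpace_eq_eigenspace (A : Matrix ι ι ℝ) (α : ℝ) :
    eigSpace A α = Module.End.eigenspace (Matrix.toEuclideanLin A) α := by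
  rw [Module.End.eigenspace_def]
  rfl

theorem hasEigenvalue_of_mem_mainEv {α : ℝ} (h : α ∈ mainEv A) :
    Module.End.HasEigenvalue (Matrix.toEuclideanLin A) α := by
  refine Module.End.hasEigenvalue_of_hasEigenvector (x := onesComponent A α)
    ⟨Module.End.mem_eigenspace_iff.2 (toEuclideanLin_onesComponent A α), ?_⟩
  exact fun h' => onesComponent_eq_zero_iff.1 h' h

theorem mainEv_finite (A : Matrix ι ι ℝ) : (mainEv A).Finite :=
  (Module.End.finite_hasEigenvalue (Matrix.toEuclideanLin A)).subset fun _ h =>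
    hasEigenvalue_of_mem_mainEv h

theorem mainEv_subset_evSet : mainEv A ⊆ evSet A := by
  intro α h
  refine ⟨WithLp.ofLp (onesComponent A α), ?_, ?_⟩
  · intro h'
    exact onesComponent_eq_zero_iff.1 ((WithLp.ofLp_eq_zero 2).1 h') h
  · have := congrArg WithLp.ofLp (toEuclideanLin_onesComponent A α)
    simpa [Matrix.toLpLin_apply] using this

theorem sum_onesComponent (hA : A.IsHermitian) :
    ∑ α ∈ (mainEv_finite A).toFinset, onesComponent A α = onesE ι := by
  have hT : (Matrix.toEuclideanLin A).IsSymmetric := Matrix.isSymmetric_toEuclideanLin_iff.2 hA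
  have htop := Submodule.orthogonal_eq_bot_iff.mp hT.orthogonalComplement_iSup_eigenspaces_eq_bot'
  have hsum := hT.orthogonalFamily_eigenspaces'.sum_projection_of_mem_iSup (onesE ι)
    (htop ▸ Submodule.mem_top)
  have hcomp : ∀ α : ℝ, (Module.End.eigenspace (Matrix.toEuclideanLin A) α).starProjection
      (onesE ι) = onesComponent A α := fun α => by
    simp only [onesComponent, eigSpace_eq_eigenspace]
  simp only [hcomp] at hsum
  rw [← hsum, ← Finset.sum_image (f := fun α => onesComponent A α)
    (g := fun μ : Module.End.Eigenvalues (Matrix.toEuclideanLin A) => (μ : ℝ))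
    (fun _ _ _ _ h => Subtype.ext h)]
  refine Finset.sum_subset (fun α hα => ?_) fun α _ hα => ?_
  · exact Finset.mem_image.2 ⟨⟨α, hasEigenvalue_of_mem_mainEv (by simpa using hα)⟩,
      Finset.mem_univ _, rfl⟩
  · exact onesComponent_eq_zero_iff.2 (by simpa using hα)

theorem det_add_smul_ne_zero_iff {lam : ℝ} :
    (A + (2 + lam) • (1 : Matrix ι ι ℝ)).det ≠ 0 ↔ -2 - lam ∉ evSet A := by
  rw [ne_eq, not_iff_not, ← Matrix.exists_mulVec_eq_zero_iff]
  refine exists_congr fun v => and_congr_right fun _ => ?_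
  rw [Matrix.add_mulVec, Matrix.smul_mulVec, Matrix.one_mulVec,
    show (-2 - lam) • v = -((2 + lam) • v) by rw [← neg_smul]; ring_nf, eq_neg_iff_add_eq_zero]

theorem inner_onesE {ι : Type*} [Fintype ι] (h : ι → ℝ) :
    inner ℝ (onesE ι) (WithLp.toLp 2 h) = ∑ x, h x := by
  simp [onesE, PiLp.inner_apply]

theorem sum_eq_of_mulVec_eq_const (hA : A.IsHermitian) {lam c : ℝ}
    (hdet : -2 - lam ∉ evSet A) {h : ι → ℝ}
    (hh : ∀ x, A.mulVec h x + (2 + lam) * h x = c) :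
    ∑ x, h x = c * ∑ α ∈ (mainEv_finite A).toFinset, projNormSq A α / (α + 2 + lam) := by
  have hT : (Matrix.toEuclideanLin A).IsSymmetric := Matrix.isSymmetric_toEuclideanLin_iff.2 hA
  rw [← inner_onesE, ← sum_onesComponent hA, sum_inner, Finset.mul_sum]
  refine Finset.sum_congr rfl fun α hα => ?_
  have hne : α + 2 + lam ≠ 0 := fun h0 => hdet <| by
    rw [show -2 - lam = α by linarith]
    exact mainEv_subset_evSet (by simpa using hα)
  have hvec : Matrix.toEuclideanLin A (WithLp.toLp 2 h) + (2 + lam) • WithLp.toLp 2 h =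
      c • onesE ι := by
    ext x
    simpa [Matrix.toLpLin_apply, onesE] using hh x
  have hinner := congrArg (inner ℝ (onesComponent A α)) hvec
  rw [inner_add_right, ← hT, toEuclideanLin_onesComponent, real_inner_smul_left,
    real_inner_smul_right, real_inner_smul_right, ← projNormSq_eq_inner] at hinner
  rw [mul_div_assoc', eq_div_iff hne]
  linarith

theorem omegaFun_eq_sum (A : Matrix ι ι ℝ) (lam : ℝ) :
    omegaFun A lam = 1 + projNormSq A (-2) +
      ∑ α ∈ (mainEv_finite A).toFinset.erase (-2), lam / (α + 2 + lam) * projNormSq A α := by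
  rw [omegaFun, ← finsum_mem_coe_finset]
  simp

/-- The total mass of a vertex of `G` and its copy of `H` in a solution of the basic
equations. -/
theorem add_sum_eq_mul_omegaFun (hA : A.IsHermitian) {lam g : ℝ} (hdet : -2 - lam ∉ evSet A)
    {h : ι → ℝ} (hh : ∀ x, A.mulVec h x + (2 + lam) * h x = lam * g) :
    g + ∑ x, h x = g * omegaFun A lam := by
  rw [sum_eq_of_mulVec_eq_const hA hdet hh, omegaFun_eq_sum]
  have hs : ∑ α ∈ (mainEv_finite A).toFinset.erase (-2), lam / (α + 2 + lam) * projNormSq A α =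
      lam * ∑ α ∈ (mainEv_finite A).toFinset.erase (-2), projNormSq A α / (α + 2 + lam) := by
    rw [Finset.mul_sum]
    exact Finset.sum_congr rfl fun α _ => by ring
  rw [hs]
  by_cases hm : (-2 : ℝ) ∈ mainEv A
  · have hlam : lam ≠ 0 := fun h0 => hdet <| by
      rw [h0, sub_zero]
      exact mainEv_subset_evSet hm
    rw [← Finset.add_sum_erase _ _ (show (-2 : ℝ) ∈ (mainEv_finite A).toFinset by simpa using hm)]
    have hpole : lam * (projNormSq A (-2) / (-2 + 2 + lam)) = projNormSq A (-2) := by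
      rw [neg_add_cancel, zero_add, mul_div_cancel₀ _ hlam]
    linear_combination g * hpole
  · rw [Finset.erase_eq_of_notMem (by simpa using hm)]
    have : projNormSq A (-2) = 0 := by simpa [mainEv] using hm
    rw [this]
    ring

theorem exists_mem_mainEv_ne_neg_two [Nonempty ι] (hA : A.IsHermitian)
    (hnonneg : ∀ x y, 0 ≤ A x y) : ∃ α ∈ mainEv A, α ≠ -2 := by
  by_contra! hall
  have hones : Matrix.toEuclideanLin A (onesE ι) = (-2 : ℝ) • onesE ι := by
    rw [← sum_onesComponent hA, map_sum, Finset.smul_sum]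
    refine Finset.sum_congr rfl fun α hα => ?_
    rw [toEuclideanLin_onesComponent, hall α (by simpa using hα)]
  obtain ⟨x⟩ := ‹Nonempty ι›
  have hx := congrArg (fun v : EuclideanSpace ℝ ι => v x) hones
  simp [Matrix.toLpLin_apply, onesE, Matrix.mulVec, dotProduct] at hx
  have := Finset.sum_nonneg fun y (_ : y ∈ Finset.univ) => hnonneg x y
  linarith

/-- On `(λ*, ∞)` the function `ψ_A` is a strictly increasing surjection onto `ℝ`, and `λ*` is an
upper bound of the zeros of `ω_A`. -/
theorem psiFun_rightmost_branch (hmain : ∃ α ∈ mainEv A, α ≠ -2) :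
    StrictMonoOn (psiFun A) (Set.Ioi (lamStar A)) ∧
      (∀ y, ∃ x, lamStar A < x ∧ psiFun A x = y) ∧ ∀ x ∈ omegaZeros A, x ≤ lamStar A := by
  set s := (mainEv_finite A).toFinset.erase (-2) with hs
  have hmem : ∀ α, α ∈ s ↔ α ∈ mainEv A \ {(-2 : ℝ)} := fun α => by simp [hs, and_comm]
  have hinj : Function.Injective fun α : ℝ => -α - 2 := fun a b h => by simpa using h
  set S := insert 0 (s.image fun α => -α - 2) with hS
  have hmemS : ∀ t, t ∈ S ↔ t = 0 ∨ -t - 2 ∈ mainEv A \ {(-2 : ℝ)} := fun t => by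
    rw [hS, Finset.mem_insert, Finset.mem_image]
    refine or_congr_right ⟨?_, fun h => ⟨-t - 2, (hmem _).2 h, by ring⟩⟩
    rintro ⟨α, hα, rfl⟩
    rw [← hmem]
    simpa using hα
  have h0 : (0 : ℝ) ∉ s.image fun α => -α - 2 := by
    rw [Finset.mem_image]
    rintro ⟨α, hα, h⟩
    exact ((hmem α).1 hα).2 (Set.mem_singleton_iff.2 (by linarith))
  let c : ℝ → ℝ := fun t => if t = 0 then 1 + projNormSq A (-2) else projNormSq A (-t - 2)
  have hpos₀ : 0 < 1 + projNormSq A (-2) := by linarith [projNormSq_nonneg A (-2)]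
  have hc : ∀ t ∈ S, 0 < c t := by
    intro t ht
    by_cases h : t = 0
    · simpa [c, h] using hpos₀
    · simp only [c, h, if_false]
      exact lt_of_le_of_ne (projNormSq_nonneg A _) (Ne.symm (((hmemS t).1 ht).resolve_left h).1)
  have hnon : S.Nontrivial := by
    obtain ⟨α, hα, hne⟩ := hmain
    have hα' : -α - 2 ∈ s.image fun α => -α - 2 :=
      Finset.mem_image_of_mem _ ((hmem α).2 ⟨hα, hne⟩)
    exact ⟨0, by simp [hS], -α - 2, by simp only [hS, Finset.coe_insert]; exact Or.inr hα',
      fun h => h0 (h ▸ hα')⟩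
  have homega : ∀ x, x ≠ 0 → omegaFun A x = x * ∑ t ∈ S, c t / (x - t) := by
    intro x hx
    rw [omegaFun_eq_sum, hS, Finset.sum_insert h0, Finset.sum_image fun _ _ _ _ h => hinj h,
      mul_add, Finset.mul_sum]
    congr 1
    · simp only [c, if_true, sub_zero]
      field_simp
    · refine Finset.sum_congr rfl fun α hα => ?_
      have hα0 : -α - 2 ≠ 0 := fun h => h0 (h ▸ Finset.mem_image_of_mem (fun α => -α - 2) hα)
      simp only [c, hα0, if_false]
      rw [show x - (-α - 2) = α + 2 + x by ring, show -(-α - 2) - 2 = α by ring]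
      ring
  have homega₀ : omegaFun A 0 ≠ 0 := by
    rw [omegaFun_eq_sum]
    simpa using hpos₀.ne'
  have hdom : ∀ x, x ∈ omegaDomain A ↔ -x - 2 ∉ mainEv A \ {(-2 : ℝ)} := by
    intro x
    refine ⟨fun h hx => h _ hx (by ring), fun h α hα hx => h ?_⟩
    rwa [hx, show -(-α - 2) - 2 = α by ring]
  obtain ⟨t₁, z, u, ht₁, hzt, huz, hupos, hlast, hu, hmono, hsurj⟩ :=
    exists_rightmost_branch S c hnon hc
  have hzS : z ∉ S := fun h => hzt.ne (hlast z h le_rfl)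
  have hz0 : z ≠ 0 := fun h => hzS ((hmemS z).2 (Or.inl h))
  have hzzero : z ∈ omegaZeros A := by
    refine ⟨(hdom z).2 fun h => hzS ((hmemS z).2 (Or.inr h)), ?_⟩
    have := hu z hzt.ne
    rw [huz, eq_comm, mul_eq_zero] at this
    rw [homega z hz0, this.resolve_left (sub_ne_zero.2 hzt.ne), mul_zero]
  have hub : ∀ x ∈ omegaZeros A, x ≤ z := by
    rintro x ⟨hx, hx0⟩
    by_contra! h
    have hne : x ≠ 0 := fun h => homega₀ (h ▸ hx0)
    have hxt : x ≠ t₁ := by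
      rintro rfl
      exact ((hmemS x).1 ht₁).elim hne ((hdom x).1 hx)
    rw [homega x hne, mul_eq_zero] at hx0
    have := hupos x h
    rw [hu x hxt, hx0.resolve_left hne, mul_zero] at this
    exact lt_irrefl _ this
  have hstar : lamStar A = z := (show IsGreatest (omegaZeros A) z from ⟨hzzero, hub⟩).csSup_eq
  have hpsi : Set.EqOn (fun x => (x - t₁) / u x) (psiFun A) (Set.Ioi z) := by
    intro x hx
    simp only [psiFun]
    by_cases hxt : x = t₁
    · subst hxt
      rcases (hmemS x).1 ht₁ with h | h
      · subst h
        simp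
      · rw [if_pos h]
        simp
    · have hxS : x ∉ S := fun h => hxt (hlast x h (le_of_lt hx))
      have hx0 : x ≠ 0 := fun h => hxS ((hmemS x).2 (Or.inl h))
      rw [if_neg fun h => hxS ((hmemS x).2 (Or.inr h)), hu x hxt, homega x hx0,
        div_mul_cancel_left₀ (sub_ne_zero.2 hxt), div_mul_cancel_left₀ hx0]
  rw [hstar]
  refine ⟨hmono.congr hpsi, fun y => ?_, hub⟩
  obtain ⟨x, hx, hy⟩ := hsurj y
  exact ⟨x, hx, (hpsi hx).symm.trans hy⟩

theorem psiStarInv_spec (hmain : ∃ α ∈ mainEv A, α ≠ -2) (y : ℝ) :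
    lamStar A < psiStarInv A y ∧ psiFun A (psiStarInv A y) = y := by
  obtain ⟨hmono, hsurj, -⟩ := psiFun_rightmost_branch hmain
  obtain ⟨x, hx, hxy⟩ := hsurj y
  have : {lam : ℝ | lamStar A < lam ∧ psiFun A lam = y} = {x} := by
    ext x'
    refine ⟨fun h => hmono.injOn h.1 hx (h.2.trans hxy.symm), ?_⟩
    rintro rfl
    exact ⟨hx, hxy⟩
  rw [psiStarInv, this, csSup_singleton]
  exact ⟨hx, hxy⟩

end Spectral

section Corona

variable {V₁ V₂ : Type*} [Fintype V₁] [Fintype V₂] {G : SimpleGraph V₁} (H : SimpleGraph V₂)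

theorem sum_corona_dist_none (hG : G.Connected) (f : V₁ × Option V₂ → ℝ) (i : V₁) :
    ∑ q, ((corona G H).dist (i, none) q : ℝ) * f q =
      ∑ j, (G.dist i j : ℝ) * (f (j, none) + ∑ b, f (j, some b)) + ∑ j, ∑ b, f (j, some b) := by
  simp only [Fintype.sum_prod_type, Fintype.sum_option, corona_dist H hG, coronaDist,
    ← Finset.sum_add_distrib, Nat.cast_add, Nat.cast_one, ← Finset.mul_sum]
  exact Finset.sum_congr rfl fun j _ => by ring

theorem sum_corona_dist_some [DecidableEq V₂] [DecidableRel H.Adj] (hG : G.Connected)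
    (f : V₁ × Option V₂ → ℝ) (i : V₁) (a : V₂) :
    ∑ q, ((corona G H).dist (i, some a) q : ℝ) * f q =
      ∑ q, ((corona G H).dist (i, none) q : ℝ) * f q +
        ∑ j, (f (j, none) + ∑ b, f (j, some b)) -
        ((H.adjMatrix ℝ).mulVec (fun b => f (i, some b)) a + 2 * f (i, some a)) := by
  have hcast : ∀ j b, (coronaDist G H (j, some b) (i, some a) : ℝ) =
      (G.dist i j : ℝ) + 2 - if i = j then H.adjMatrix ℝ a b + 2 * (if a = b then 1 else 0) else 0 := by
    intro j b
    simp only [coronaDist, SimpleGraph.adjMatrix_apply]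
    split_ifs <;> simp_all
    norm_num
  have hsum : ∑ j, ∑ b, (if i = j then H.adjMatrix ℝ a b + 2 * (if a = b then 1 else 0) else 0) *
      f (j, some b) =
        (H.adjMatrix ℝ).mulVec (fun b => f (i, some b)) a + 2 * f (i, some a) := by
    rw [Finset.sum_eq_single i (fun j _ hj => by simp [Ne.symm hj]) (by simp)]
    simp [add_mul, Finset.sum_add_distrib, Matrix.mulVec, dotProduct]
  rw [sum_corona_dist_none H hG, ← hsum]
  simp only [Fintype.sum_prod_type, Fintype.sum_option, corona_dist H hG, hcast, sub_mul,
    Finset.sum_sub_distrib, ← Finset.sum_add_distrib]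
  simp only [← add_sub_assoc, Finset.sum_sub_distrib]
  congr 1
  refine Finset.sum_congr rfl fun j _ => ?_
  simp only [coronaDist, ← Finset.mul_sum]
  push_cast
  ring

end Corona

theorem mem_lambdaS_of_ne_zero {V : Type*} [Fintype V] {G : SimpleGraph V} {lam κ : ℝ} {f : V → ℝ}
    (hf : f ≠ 0) (h₀ : (∑ x, f x) = 0)
    (h : ∀ x, (∑ y, (G.dist x y : ℝ) * f y) - lam * f x = κ) : lam ∈ lambdaS G := by
  have hN : 0 < ∑ x, f x ^ 2 := sum_sq_pos hf
  set s := (Real.sqrt (∑ x, f x ^ 2))⁻¹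
  have hs : s ^ 2 = (∑ x, f x ^ 2)⁻¹ := by simp [s, inv_pow, Real.sq_sqrt hN.le]
  refine ⟨fun x => s * f x, 2 * (s * κ), fun x => ?_, ?_, ?_⟩
  · rw [← h x, mul_sub, Finset.mul_sum]
    simp only [mul_left_comm]
    ring
  · rw [← Finset.mul_sum, h₀, mul_zero]
  · simp only [mul_pow, ← Finset.mul_sum, hs]
    exact inv_mul_cancel₀ hN.ne'

section Corona

variable {V₁ V₂ : Type*} [Fintype V₁] [Fintype V₂] [DecidableEq V₂]
  {G : SimpleGraph V₁} {H : SimpleGraph V₂} [DecidableRel H.Adj]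

theorem psiFun_eq_div {A : Matrix V₂ V₂ ℝ} {lam : ℝ} (hdet : -2 - lam ∉ evSet A) :
    psiFun A lam = lam / omegaFun A lam := by
  rw [psiFun, if_neg]
  intro h
  refine hdet (mainEv_subset_evSet ?_)
  rw [show -2 - lam = -lam - 2 by ring]
  exact h.1

theorem mem_omegaDomain {A : Matrix V₂ V₂ ℝ} {lam : ℝ} (hdet : -2 - lam ∉ evSet A) :
    lam ∈ omegaDomain A := by
  rintro α hα rfl
  refine hdet (mainEv_subset_evSet ?_)
  rw [show -2 - (-α - 2) = α by ring]
  exact hα.1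

theorem mem_lambdaS_corona (hG : G.Connected) (hV₁ : 2 ≤ Fintype.card V₁) {lam : ℝ}
    (hdet : -2 - lam ∉ evSet (H.adjMatrix ℝ)) (homega : omegaFun (H.adjMatrix ℝ) lam ≠ 0)
    (hpsi : psiFun (H.adjMatrix ℝ) lam = QEC G) : lam ∈ lambdaS (corona G H) := by
  obtain ⟨g, μ, hg, hg₀, hg₁⟩ := QEC_mem_lambdaS G hV₁
  rw [psiFun_eq_div hdet, div_eq_iff homega] at hpsi
  set M := H.adjMatrix ℝ + (2 + lam) • (1 : Matrix V₂ V₂ ℝ)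
  have hM : IsUnit M.det := (det_add_smul_ne_zero_iff.2 hdet).isUnit
  set r : V₂ → ℝ := M⁻¹.mulVec 1
  have hr : ∀ a, (H.adjMatrix ℝ).mulVec r a + (2 + lam) * r a = 1 := by
    intro a
    have : M.mulVec r = 1 := by
      rw [Matrix.mulVec_mulVec, Matrix.mul_nonsing_inv M hM, Matrix.one_mulVec]
    have := congrFun this a
    simpa [M, Matrix.add_mulVec, Matrix.smul_mulVec] using this
  let f : V₁ × Option V₂ → ℝ := fun p => g p.1 * p.2.elim 1 fun a => lam * r a
  have hh : ∀ i a, (H.adjMatrix ℝ).mulVec (fun b => f (i, some b)) a + (2 + lam) * f (i, some a) =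
      lam * g i := by
    intro i a
    have : (fun b => f (i, some b)) = (g i * lam) • r := by
      ext b
      simp [f, mul_assoc]
    rw [this, Matrix.mulVec_smul]
    simp only [f, Option.elim, Pi.smul_apply, smul_eq_mul]
    linear_combination g i * lam * hr a
  have hF : ∀ i, f (i, none) + ∑ b, f (i, some b) = g i * omegaFun (H.adjMatrix ℝ) lam := by
    intro i
    rw [← add_sum_eq_mul_omegaFun (H.isHermitian_adjMatrix ℝ) hdet (hh i)]
    simp [f]
  have hFsum : ∑ i, (f (i, none) + ∑ b, f (i, some b)) = 0 := by
    simp only [hF, ← Finset.sum_mul, hg₀, zero_mul]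
  have hnone : ∀ i, ∑ q, ((corona G H).dist (i, none) q : ℝ) * f q - lam * g i =
      omegaFun (H.adjMatrix ℝ) lam * (μ / 2) + ∑ j, ∑ b, f (j, some b) := by
    intro i
    rw [sum_corona_dist_none H hG, ← hg i]
    simp only [hF, ← mul_assoc, ← Finset.sum_mul]
    linear_combination (-g i) * hpsi
  refine mem_lambdaS_of_ne_zero (f := f) ?_ ?_
    (κ := omegaFun (H.adjMatrix ℝ) lam * (μ / 2) + ∑ j, ∑ b, f (j, some b)) ?_
  · intro h
    have : g = 0 := by
      ext i
      simpa [f] using congrFun h (i, none)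
    simp [this] at hg₁
  · rw [Fintype.sum_prod_type]
    simpa only [Fintype.sum_option] using hFsum
  · rintro ⟨i, _ | a⟩
    · simpa [f] using hnone i
    · rw [sum_corona_dist_some H hG, hFsum]
      linear_combination hnone i - hh i a

theorem psiFun_le_QEC_of_mem_lambdaS_corona (hG : G.Connected) (hV₁ : 2 ≤ Fintype.card V₁)
    {lam : ℝ} (hdet : -2 - lam ∉ evSet (H.adjMatrix ℝ))
    (homega : omegaFun (H.adjMatrix ℝ) lam ≠ 0) (hlam : lam ∈ lambdaS (corona G H)) :
    psiFun (H.adjMatrix ℝ) lam ≤ QEC G := by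
  obtain ⟨f, μ, hf, hf₀, hf₁⟩ := hlam
  have hFsum : ∑ i, (f (i, none) + ∑ b, f (i, some b)) = 0 := by
    simpa only [Fintype.sum_prod_type, Fintype.sum_option] using hf₀
  have hh : ∀ i a, (H.adjMatrix ℝ).mulVec (fun b => f (i, some b)) a + (2 + lam) * f (i, some a) =
      lam * f (i, none) := by
    intro i a
    have h₁ := hf (i, some a)
    have h₂ := hf (i, none)
    rw [sum_corona_dist_some H hG, hFsum] at h₁
    linarith
  have hF : ∀ i, f (i, none) + ∑ b, f (i, some b) =
      f (i, none) * omegaFun (H.adjMatrix ℝ) lam := fun i =>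
    add_sum_eq_mul_omegaFun (H.isHermitian_adjMatrix ℝ) hdet (hh i)
  rw [psiFun_eq_div hdet]
  refine le_QEC_of_solution G hV₁ (f := fun i => f (i, none))
    (κ := (μ / 2 - ∑ j, ∑ b, f (j, some b)) / omegaFun (H.adjMatrix ℝ) lam) ?_ ?_ fun i => ?_
  · intro hg
    have hM := det_add_smul_ne_zero_iff.2 hdet
    have hzero : ∀ i, (fun b => f (i, some b)) = 0 := by
      intro i
      refine Matrix.eq_zero_of_mulVec_eq_zero hM ?_
      ext a
      have := hh i a
      rw [show f (i, none) = 0 from congrFun hg i, mul_zero] at this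
      simpa [Matrix.add_mulVec, Matrix.smul_mulVec] using this
    have : f = 0 := by
      ext ⟨i, _ | a⟩
      · exact congrFun hg i
      · exact congrFun (hzero i) a
    simp [this] at hf₁
  · simp only [hF, ← Finset.sum_mul] at hFsum
    exact (mul_eq_zero.1 hFsum).resolve_right homega
  · have h := hf (i, none)
    rw [sum_corona_dist_none H hG] at h
    simp only [hF, ← mul_assoc, ← Finset.sum_mul] at h
    field_simp
    linarith

end Corona

/-- `max (Γ₁ ∪ Γ₂) = ψ_{H*}⁻¹(QEC(G))`, together with
`λ* < ψ_{H*}⁻¹(−1) ≤ max (Γ₁ ∪ Γ₂)`. -/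
theorem max_Gamma12 {V₁ V₂ : Type*} [Fintype V₁] [Fintype V₂] [DecidableEq V₂]
    (G : SimpleGraph V₁) (H : SimpleGraph V₂) [DecidableRel H.Adj]
    (hG : G.Connected) (hV₁ : 2 ≤ Fintype.card V₁) (hV₂ : 1 ≤ Fintype.card V₂)
    (hev : -2 - psiStarInv (H.adjMatrix ℝ) (QEC G) ∉ evSet (H.adjMatrix ℝ)) :
    IsGreatest (lambdaS (corona G H) ∩
        {lam : ℝ | (H.adjMatrix ℝ + (2 + lam) • (1 : Matrix V₂ V₂ ℝ)).det ≠ 0})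
      (psiStarInv (H.adjMatrix ℝ) (QEC G)) ∧
    lamStar (H.adjMatrix ℝ) < psiStarInv (H.adjMatrix ℝ) (-1) ∧
    psiStarInv (H.adjMatrix ℝ) (-1) ≤ psiStarInv (H.adjMatrix ℝ) (QEC G) := by
  set A := H.adjMatrix ℝ with hA
  have : Nonempty V₂ := Fintype.card_pos_iff.1 hV₂
  have hmain : ∃ α ∈ mainEv A, α ≠ -2 :=
    exists_mem_mainEv_ne_neg_two (H.isHermitian_adjMatrix ℝ) fun x y => by
      rw [hA, SimpleGraph.adjMatrix_apply]
      split_ifs <;> norm_num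
  obtain ⟨hmono, -, hzeros⟩ := psiFun_rightmost_branch hmain
  obtain ⟨hq, hpsiq⟩ := psiStarInv_spec hmain (QEC G)
  obtain ⟨hm, hpsim⟩ := psiStarInv_spec hmain (-1)
  refine ⟨⟨⟨mem_lambdaS_corona hG hV₁ hev (fun h => ?_) hpsiq, det_add_smul_ne_zero_iff.2 hev⟩, ?_⟩,
    hm, ?_⟩
  · exact hq.not_ge (hzeros _ ⟨mem_omegaDomain hev, h⟩)
  · rintro lam ⟨hlam, hdet⟩
    replace hdet := det_add_smul_ne_zero_iff.1 hdet
    by_contra! hlt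
    have homega : omegaFun A lam ≠ 0 := fun h =>
      (hq.trans hlt).not_ge (hzeros _ ⟨mem_omegaDomain hdet, h⟩)
    have h₁ := psiFun_le_QEC_of_mem_lambdaS_corona hG hV₁ hdet homega hlam
    have h₂ := hmono hq (hq.trans hlt) hlt
    rw [hpsiq] at h₂
    exact h₂.not_ge h₁
  · rw [← hmono.le_iff_le hm hq, hpsim, hpsiq]
    exact neg_one_le_QEC G hG hV₁

end QECPaper
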